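/- Catalan-number identity from Theorem 5.2 (total dimension of support τ-tilting modules over path algebras of type 𝔸_n): for every integer n ≥ 0, ∑_{ℓ=1}^{n} ℓ·C_ℓ·(n−ℓ+1)·C_{n−ℓ+1} = 4^{n+1} − (n+2)·C_{n+2}. -/

import Mathlib

open Finset

theorem sum_antidiagonal_fst_mul_comm {R : Type*} [CommSemiring R] (f : ℕ → R) (n : ℕ) :
    ∑ p ∈ antidiagonal n, (p.1 : R) * f p.1 * f p.2
      = ∑ p ∈ antidiagonal n, (p.2 : R) * f p.2 * f p.1 :=
  (Finset.Nat.sum_antidiagonal_swap (f := fun p : ℕ × ℕ => (p.1 : R) * f p.1 * f p.2)).symm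

/-- In a self-convolution, weighting by the first index is half of weighting by the total. -/
theorem two_mul_sum_antidiagonal_fst_mul {R : Type*} [CommSemiring R] (f : ℕ → R) (n : ℕ) :
    2 * ∑ p ∈ antidiagonal n, (p.1 : R) * f p.1 * f p.2
      = n * ∑ p ∈ antidiagonal n, f p.1 * f p.2 := by
  rw [two_mul]
  nth_rewrite 2 [sum_antidiagonal_fst_mul_comm]
  rw [← sum_add_distrib, mul_sum]
  refine sum_congr rfl fun p hp => ?_
  rw [← mem_antidiagonal.mp hp]
  push_cast
  ring

theorem sum_antidiagonal_centralBinom_mul_centralBinom (n : ℕ) :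
    ∑ p ∈ antidiagonal n, (Nat.centralBinom p.1 : ℤ) * Nat.centralBinom p.2 = 4 ^ n := by
  induction n with
  | zero => simp
  | succ n ih =>
    have h₁ := two_mul_sum_antidiagonal_fst_mul (fun k => (Nat.centralBinom k : ℤ)) (n + 1)
    have h₂ := two_mul_sum_antidiagonal_fst_mul (fun k => (Nat.centralBinom k : ℤ)) n
    have hrec : ∑ p ∈ antidiagonal (n + 1),
          (p.1 : ℤ) * Nat.centralBinom p.1 * Nat.centralBinom p.2
        = 2 * (2 * ∑ p ∈ antidiagonal n,
            (p.1 : ℤ) * Nat.centralBinom p.1 * Nat.centralBinom p.2) + 2 * 4 ^ n := by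
      rw [← ih, Finset.Nat.sum_antidiagonal_succ, mul_sum, mul_sum, mul_sum, ← sum_add_distrib]
      simp only [Nat.cast_zero, zero_mul, zero_add]
      refine sum_congr rfl fun p _ => ?_
      have h : ((p.1 + 1 : ℕ) : ℤ) * Nat.centralBinom (p.1 + 1)
          = 2 * (2 * p.1 + 1) * Nat.centralBinom p.1 := by
        exact_mod_cast Nat.succ_mul_centralBinom_succ p.1
      rw [h]
      ring
    rw [hrec, h₂, ih] at h₁
    have hn : ((n + 1 : ℕ) : ℤ) ≠ 0 := by positivity
    refine mul_left_cancel₀ hn ?_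
    rw [← h₁]
    push_cast
    ring

theorem sum_antidiagonal_catalan_mul_catalan (n : ℕ) :
    ∑ p ∈ antidiagonal n, (catalan p.1 : ℤ) * catalan p.2 = catalan (n + 1) := by
  rw [catalan_succ']
  push_cast
  rfl

theorem natCast_mul_catalan (n : ℕ) :
    (n : ℤ) * catalan n = Nat.centralBinom n - catalan n := by
  rw [← succ_mul_catalan_eq_centralBinom]
  push_cast
  ring

theorem sum_antidiagonal_mul_catalan_mul_mul_catalan (n : ℕ) :
    ∑ p ∈ antidiagonal n, ((p.1 : ℤ) * catalan p.1) * (p.2 * catalan p.2)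
      = 4 ^ n - (n + 1) * catalan (n + 1) := by
  have h := two_mul_sum_antidiagonal_fst_mul (fun k => (catalan k : ℤ)) n
  have key : ∑ p ∈ antidiagonal n, ((p.1 : ℤ) * catalan p.1) * (p.2 * catalan p.2)
      = ∑ p ∈ antidiagonal n, (Nat.centralBinom p.1 : ℤ) * Nat.centralBinom p.2
        - ∑ p ∈ antidiagonal n, (p.1 : ℤ) * catalan p.1 * catalan p.2
        - ∑ p ∈ antidiagonal n, (p.2 : ℤ) * catalan p.2 * catalan p.1
        - ∑ p ∈ antidiagonal n, (catalan p.1 : ℤ) * catalan p.2 := by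
    simp only [← sum_sub_distrib]
    refine sum_congr rfl fun p _ => ?_
    rw [natCast_mul_catalan, natCast_mul_catalan]
    ring
  rw [sum_antidiagonal_catalan_mul_catalan] at h
  rw [key, ← sum_antidiagonal_fst_mul_comm (fun k => (catalan k : ℤ)), sum_antidiagonal_centralBinom_mul_centralBinom,
    sum_antidiagonal_catalan_mul_catalan]
  linear_combination -h

/-- Catalan-number identity from Theorem 5.2: for every `n ≥ 0`,
`∑_{ℓ=1}^n ℓ·C_ℓ·(n-ℓ+1)·C_{n-ℓ+1} = 4^{n+1} − (n+2)·C_{n+2}` (stated in `ℤ`). -/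
theorem catalan_sum_identity (n : ℕ) :
    ∑ ℓ ∈ Finset.Icc 1 n,
        ((ℓ : ℤ) * catalan ℓ * ((n - ℓ + 1 : ℕ) : ℤ) * catalan (n - ℓ + 1))
      = 4 ^ (n + 1) - ((n : ℤ) + 2) * catalan (n + 2) := by
  have h := sum_antidiagonal_mul_catalan_mul_mul_catalan (n + 1)
  rw [Finset.Nat.sum_antidiagonal_eq_sum_range_succ_mk] at h
  have hsub : Icc 1 n ⊆ range (n + 1).succ := fun k hk => by
    simp only [mem_Icc, mem_range] at *
    omega
  rw [← sum_subset hsub] at h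
  · trans 4 ^ (n + 1) - (((n + 1 : ℕ) : ℤ) + 1) * catalan (n + 1 + 1)
    · rw [← h]
      refine sum_congr rfl fun k hk => ?_
      rw [mem_Icc] at hk
      rw [show n + 1 - k = n - k + 1 by omega]
      ring
    · push_cast
      ring
  · intro k hk hk'
    simp only [mem_Icc, mem_range] at hk hk'
    obtain rfl | rfl : k = 0 ∨ k = n + 1 := by omega
    · simp
    · simp
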